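/- Let n ∈ ℕ, let c_0, …, c_{2^n} ∈ ℝ, and let f : [0,∞) → ℝ be integrable. Define the transition operator (Tf)(x) = Σ_{k=0}^{2^n} c_k·f(2x ⊖ k) and the mask m(y) = (1/2)·Σ_{k=0}^{2^n} c_k·w_k(y). Then Tf is integrable and its Walsh–Fourier transform satisfies (𝔉(Tf))(y) = m(y/2)·(𝔉f)(y/2) for every y ∈ [0,∞). -/

import Mathlib

open MeasureTheory Finset

/-- The `j`-th binary digit of `x` after the binary point. -/
noncomputable def binDigit (j : ℕ) (x : ℝ) : ℕ := (⌊(2:ℝ)^j * x⌋).toNat % 2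

/-- The Walsh function `w_k(x) = (-1)^{∑ k_i d_{i+1}(x)}`. -/
noncomputable def walsh (k : ℕ) (x : ℝ) : ℝ :=
  (-1 : ℝ) ^ (∑ i ∈ Finset.range (k+1), (k / 2^i % 2) * binDigit (i+1) x)

/-- The generalized Walsh kernel `ψ(x,y) = w_{⌊y⌋}(x) · w_{⌊x⌋}(y)`. -/
noncomputable def walshKernel (x y : ℝ) : ℝ := walsh (⌊y⌋).toNat x * walsh (⌊x⌋).toNat y

/-- The Walsh–Fourier transform `(𝔉f)(y) = ∫_{[0,∞)} ψ(x,y) f(x) dx`. -/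
noncomputable def walshFourier (f : ℝ → ℝ) (y : ℝ) : ℝ :=
  ∫ x in Set.Ici (0:ℝ), walshKernel x y * f x

/-- The dyadic translate `x ⊕ j = (⌊x⌋ XOR j) + (x - ⌊x⌋)`. -/
noncomputable def dyadicAdd (x : ℝ) (j : ℕ) : ℝ := ((⌊x⌋.toNat ^^^ j : ℕ) : ℝ) + (x - ⌊x⌋)

theorem walsh_eq_of_lt {k N : ℕ} (h : k < N) (x : ℝ) :
    walsh k x = (-1 : ℝ) ^ (∑ i ∈ Finset.range N, (k / 2^i % 2) * binDigit (i+1) x) := by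
  unfold walsh
  congr 1
  refine Finset.sum_subset (Finset.range_mono h) fun i _ hi => ?_
  have hki : k < i := by simpa using hi
  rw [Nat.div_eq_of_lt (hki.trans i.lt_two_pow_self)]
  simp

theorem binDigit_succ_half (j : ℕ) (x : ℝ) : binDigit (j+1) (x/2) = binDigit j x := by
  unfold binDigit
  rw [show (2:ℝ)^(j+1) * (x/2) = 2^j * x by ring]

theorem walsh_half (k : ℕ) (x : ℝ) :
    walsh k (x/2) = (-1 : ℝ) ^ ((k % 2) * (⌊x⌋.toNat % 2)) * walsh (k/2) x := by
  rw [walsh_eq_of_lt (show k < k + 2 by omega), walsh_eq_of_lt (show k/2 < k + 1 by omega),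
    Finset.sum_range_succ', ← pow_add, add_comm]
  simp only [binDigit_succ_half, pow_zero, Nat.div_one, Nat.div_div_eq_div_mul, pow_succ' 2]
  congr 3
  simp [binDigit]

theorem floor_half_toNat (y : ℝ) : ⌊y/2⌋.toNat = ⌊y⌋.toNat / 2 := by
  simp only [Int.floor_toNat, Nat.floor_div_ofNat]

theorem walshKernel_half_left (x y : ℝ) : walshKernel (x/2) y = walshKernel x (y/2) := by
  simp only [walshKernel, walsh_half, floor_half_toNat]
  rw [mul_comm (⌊y⌋.toNat % 2)]
  ring

theorem walsh_sq (k : ℕ) (x : ℝ) : walsh k x * walsh k x = 1 := by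
  unfold walsh
  rw [← mul_pow]
  simp

theorem abs_walsh (k : ℕ) (x : ℝ) : |walsh k x| = 1 := by
  simp [walsh, abs_pow]

theorem walsh_xor (a k : ℕ) (x : ℝ) : walsh (a ^^^ k) x = walsh a x * walsh k x := by
  rw [walsh_eq_of_lt (show a ^^^ k < (a ^^^ k) + a + k + 1 by omega),
    walsh_eq_of_lt (show a < (a ^^^ k) + a + k + 1 by omega),
    walsh_eq_of_lt (show k < (a ^^^ k) + a + k + 1 by omega)]
  simp only [← Finset.prod_pow_eq_pow_sum, ← Finset.prod_mul_distrib]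
  refine Finset.prod_congr rfl fun i _ => ?_
  simp only [← Nat.toNat_testBit, Nat.testBit_xor]
  cases a.testBit i <;> cases k.testBit i <;> simp [← mul_pow]

theorem floor_dyadicAdd (x : ℝ) (k : ℕ) : ⌊dyadicAdd x k⌋ = ((⌊x⌋.toNat ^^^ k : ℕ) : ℤ) := by
  unfold dyadicAdd
  rw [Int.floor_natCast_add, Int.self_sub_floor, Int.floor_fract, add_zero]

theorem dyadicAdd_nonneg (x : ℝ) (k : ℕ) : 0 ≤ dyadicAdd x k := by
  unfold dyadicAdd
  have := Int.floor_le x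
  have : (0:ℝ) ≤ ((⌊x⌋.toNat ^^^ k : ℕ) : ℝ) := Nat.cast_nonneg _
  linarith

theorem binDigit_dyadicAdd (j : ℕ) {x : ℝ} (hx : 0 ≤ x) (k : ℕ) :
    binDigit (j+1) (dyadicAdd x k) = binDigit (j+1) x := by
  have h0 : 0 ≤ ⌊(2:ℝ)^(j+1) * x⌋ := Int.floor_nonneg.2 (by positivity)
  have h1 : 0 ≤ ⌊(2:ℝ)^(j+1) * dyadicAdd x k⌋ :=
    Int.floor_nonneg.2 (mul_nonneg (by positivity) (dyadicAdd_nonneg x k))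
  have h2 : ⌊(2:ℝ)^(j+1) * dyadicAdd x k⌋ =
      ⌊(2:ℝ)^(j+1) * x⌋ + 2 * (2^j * (((⌊x⌋.toNat ^^^ k : ℕ) : ℤ) - ⌊x⌋)) := by
    rw [← Int.floor_add_intCast]
    congr 1
    unfold dyadicAdd
    push_cast
    ring
  unfold binDigit
  omega

theorem walsh_dyadicAdd (l : ℕ) {x : ℝ} (hx : 0 ≤ x) (k : ℕ) :
    walsh l (dyadicAdd x k) = walsh l x := by
  simp only [walsh, binDigit_dyadicAdd _ hx]

theorem walshKernel_dyadicAdd {x : ℝ} (hx : 0 ≤ x) (k : ℕ) (y : ℝ) :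
    walshKernel (dyadicAdd x k) y = walsh k y * walshKernel x y := by
  simp only [walshKernel, walsh_dyadicAdd _ hx, floor_dyadicAdd, Int.toNat_natCast, walsh_xor]
  ring

theorem abs_walshKernel (x y : ℝ) : |walshKernel x y| = 1 := by
  simp [walshKernel, abs_mul, abs_walsh]

theorem measurable_walsh (k : ℕ) : Measurable (walsh k) := by
  have h (j : ℕ) : Measurable (binDigit j) :=
    (measurable_of_countable fun z : ℤ => z.toNat % 2).comp
      (Int.measurable_floor.comp (measurable_const_mul _))
  exact (measurable_of_countable fun l : ℕ => (-1 : ℝ) ^ l).comp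
    (Finset.measurable_fun_sum _ fun i _ => (h (i+1)).const_mul _)

theorem measurable_walshKernel (y : ℝ) : Measurable fun x => walshKernel x y :=
  (measurable_walsh _).mul
    ((measurable_of_countable fun z : ℤ => walsh z.toNat y).comp Int.measurable_floor)

theorem measurable_dyadicAdd (k : ℕ) : Measurable fun x => dyadicAdd x k :=
  ((measurable_of_countable fun z : ℤ => ((z.toNat ^^^ k : ℕ) : ℝ)).comp Int.measurable_floor).add
    (measurable_id.sub ((measurable_of_countable fun z : ℤ => (z : ℝ)).comp Int.measurable_floor))

theorem volume_restrict_Ici_eq_sum :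
    (volume.restrict (Set.Ici 0) : Measure ℝ) =
      Measure.sum fun n : ℕ => volume.restrict (Set.Ico (n : ℝ) (n + 1)) := by
  rw [← Measure.restrict_iUnion _ fun _ => measurableSet_Ico]
  · congr 1
    ext x
    simp only [Set.mem_Ici, Set.mem_iUnion, Set.mem_Ico]
    exact ⟨fun hx => ⟨⌊x⌋₊, Nat.floor_le hx, Nat.lt_floor_add_one x⟩,
      fun ⟨n, hn, _⟩ => n.cast_nonneg.trans hn⟩
  · intro a b hab
    simpa using (Set.pairwise_disjoint_Ico_intCast ℝ) (Nat.cast_injective.ne hab : (a : ℤ) ≠ b)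

theorem map_dyadicAdd_restrict_Ico (k n : ℕ) :
    Measure.map (fun x => dyadicAdd x k) (volume.restrict (Set.Ico (n : ℝ) (n + 1))) =
      volume.restrict (Set.Ico ((n ^^^ k : ℕ) : ℝ) ((n ^^^ k : ℕ) + 1)) := by
  set c : ℝ := ((n ^^^ k : ℕ) : ℝ) - n with hc
  have h : Measure.map (fun x => dyadicAdd x k) (volume.restrict (Set.Ico (n : ℝ) (n + 1))) =
      Measure.map (fun x => x + c) (volume.restrict (Set.Ico (n : ℝ) (n + 1))) := by
    refine Measure.map_congr ?_
    filter_upwards [ae_restrict_mem measurableSet_Ico] with x hx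
    have hfl : ⌊x⌋ = (n : ℤ) := Int.floor_eq_iff.2 (by simpa using hx)
    simp only [dyadicAdd, hfl, Int.toNat_natCast, hc, Int.cast_natCast]
    ring
  have hp := ((measurePreserving_add_right (volume : Measure ℝ) c).restrict_preimage
    (measurableSet_Ico (a := ((n ^^^ k : ℕ) : ℝ)) (b := (n ^^^ k : ℕ) + 1))).map_eq
  rw [h, ← hp, Set.preimage_add_const_Ico, show ((n ^^^ k : ℕ) : ℝ) - c = n by rw [hc]; ring,
    show ((n ^^^ k : ℕ) : ℝ) + 1 - c = n + 1 by rw [hc]; ring]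

theorem measurePreserving_dyadicAdd (k : ℕ) :
    MeasurePreserving (fun x => dyadicAdd x k)
      (volume.restrict (Set.Ici 0)) (volume.restrict (Set.Ici 0)) := by
  refine ⟨measurable_dyadicAdd k, ?_⟩
  rw [volume_restrict_Ici_eq_sum, Measure.map_sum (measurable_dyadicAdd k).aemeasurable]
  simp only [map_dyadicAdd_restrict_Ico]
  have hinv : Function.Involutive fun n : ℕ => n ^^^ k := fun n => by simp
  exact Measure.sum_comp_equiv hinv.toPerm
    fun n : ℕ => (volume : Measure ℝ).restrict (Set.Ico (n : ℝ) (n + 1))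

theorem integrableOn_walshKernel_mul {f : ℝ → ℝ} (hf : IntegrableOn f (Set.Ici 0)) (y : ℝ) :
    IntegrableOn (fun x => walshKernel x y * f x) (Set.Ici 0) :=
  Integrable.bdd_mul (c := 1) hf (measurable_walshKernel y).aestronglyMeasurable
    (ae_of_all _ fun x => (abs_walshKernel x y).le)

theorem integrableOn_comp_dyadicAdd_two_mul {f : ℝ → ℝ} (hf : IntegrableOn f (Set.Ici 0)) (k : ℕ) :
    IntegrableOn (fun x => f (dyadicAdd (2*x) k)) (Set.Ici 0) := by
  have h : IntegrableOn (fun x => f (dyadicAdd x k)) (Set.Ici 0) :=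
    (measurePreserving_dyadicAdd k).integrable_comp_of_integrable hf
  rw [integrableOn_Ici_iff_integrableOn_Ioi] at h ⊢
  exact (integrableOn_Ioi_comp_mul_left_iff (fun x => f (dyadicAdd x k)) 0 two_pos).2
    (by simpa using h)

theorem walshFourier_comp_dyadicAdd_two_mul {f : ℝ → ℝ} (hf : IntegrableOn f (Set.Ici 0))
    (k : ℕ) (y : ℝ) :
    walshFourier (fun x => f (dyadicAdd (2*x) k)) y =
      (1/2) * walsh k (y/2) * walshFourier f (y/2) := by
  set G : ℝ → ℝ := fun v => walshKernel v (y/2) * f v with hG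
  have hGint : IntegrableOn G (Set.Ici 0) := integrableOn_walshKernel_mul hf _
  have hmap := measurePreserving_dyadicAdd k
  have hcomp : ∫ u in Set.Ici (0:ℝ), G (dyadicAdd u k) = ∫ v in Set.Ici (0:ℝ), G v := by
    conv_rhs => rw [← hmap.map_eq]
    exact (integral_map hmap.aemeasurable
      (hmap.map_eq.symm ▸ hGint.aestronglyMeasurable)).symm
  have hscale : ∫ x in Set.Ici (0:ℝ), G (dyadicAdd (2*x) k) =
      (1/2) * ∫ u in Set.Ici (0:ℝ), G (dyadicAdd u k) := by
    rw [integral_Ici_eq_integral_Ioi, integral_Ici_eq_integral_Ioi,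
      integral_comp_mul_left_Ioi (fun u => G (dyadicAdd u k)) 0 two_pos]
    simp
  have hint : walshFourier (fun x => f (dyadicAdd (2*x) k)) y =
      ∫ x in Set.Ici (0:ℝ), walsh k (y/2) * G (dyadicAdd (2*x) k) := by
    refine setIntegral_congr_fun measurableSet_Ici fun x hx => ?_
    have hx2 : (0:ℝ) ≤ 2 * x := mul_nonneg two_pos.le hx
    have hxy : walshKernel x y = walshKernel (2*x) (y/2) := by
      rw [← walshKernel_half_left, mul_div_cancel_left₀ x two_ne_zero]
    simp only [hG, walshKernel_dyadicAdd hx2, hxy]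
    linear_combination (- walshKernel (2*x) (y/2) * f (dyadicAdd (2*x) k)) * walsh_sq k (y/2)
  rw [hint, integral_const_mul, hscale, hcomp]
  simp only [hG, walshFourier]
  ring

/-- For integrable `f`, the transition operator `(Tf)(x) = ∑_{k=0}^{2^n} c_k f(2x ⊖ k)`
produces an integrable function with `(𝔉(Tf))(y) = m(y/2)·(𝔉f)(y/2)`, where
`m(y) = (1/2)∑ c_k w_k(y)` is the mask. -/
theorem walshFourier_transition (n : ℕ) (c : ℕ → ℝ) (f : ℝ → ℝ)
    (hf : IntegrableOn f (Set.Ici 0) volume)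
    (Tf : ℝ → ℝ)
    (hTf : ∀ x : ℝ, Tf x = ∑ k ∈ Finset.range (2^n + 1), c k * f (dyadicAdd (2*x) k))
    (m : ℝ → ℝ)
    (hm : ∀ y : ℝ, m y = (1/2) * ∑ k ∈ Finset.range (2^n + 1), c k * walsh k y) :
    IntegrableOn Tf (Set.Ici 0) volume ∧
    ∀ y : ℝ, 0 ≤ y → walshFourier Tf y = m (y/2) * walshFourier f (y/2) := by
  have hTf' : Tf = fun x => ∑ k ∈ Finset.range (2^n + 1), c k * f (dyadicAdd (2*x) k) := funext hTf
  have hterm (k : ℕ) := integrableOn_comp_dyadicAdd_two_mul hf k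
  refine ⟨?_, fun y _ => ?_⟩
  · rw [hTf']
    exact integrable_finsetSum _ fun k _ => (hterm k).const_mul (c k)
  · have hsum : walshFourier Tf y = ∑ k ∈ Finset.range (2^n + 1),
        c k * walshFourier (fun x => f (dyadicAdd (2*x) k)) y := by
      simp only [walshFourier, hTf, Finset.mul_sum, mul_left_comm _ (c _)]
      rw [integral_finsetSum _ fun k _ =>
        (integrableOn_walshKernel_mul (hterm k) y).const_mul (c k)]
      simp only [integral_const_mul]
    rw [hsum, hm, Finset.mul_sum, Finset.sum_mul]
    refine Finset.sum_congr rfl fun k _ => ?_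
    rw [walshFourier_comp_dyadicAdd_two_mul hf]
    ring
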